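/- Let n ≥ 1 and let G be a subgroup of GL_n(ℂ), the group of invertible complex n×n matrices with its standard topology, such that G is compact as a subset and G is infinite. Then G contains an element g with g ≠ 1 and g² = 1, i.e. a nontrivial element of order 2. -/

import Mathlib

open Filter Topology

namespace Stmt8Aux

open NormedSpace

variable {A : Type*} [NormedRing A] [NormedAlgebra ℝ A] [NormedAlgebra ℚ A]
  [FiniteDimensional ℝ A]

/-- `K` is a group of units. -/
structure IsGrp (K : Set A) : Prop where
  one : (1 : A) ∈ K
  mul : ∀ x ∈ K, ∀ y ∈ K, x * y ∈ K
  inv : ∀ x ∈ K, ∃ y ∈ K, x * y = 1 ∧ y * x = 1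

theorem exp_neg_mul [CompleteSpace A] (x : A) : exp (-x) * exp x = 1 := by
  rw [← exp_add_of_commute (Commute.neg_left (Commute.refl x))]
  simp

theorem exp_mul_neg [CompleteSpace A] (x : A) : exp x * exp (-x) = 1 := by
  rw [← exp_add_of_commute (Commute.neg_right (Commute.refl x))]
  simp

theorem IsGrp.exp_neg [CompleteSpace A] {K : Set A} (hK : IsGrp K) {x : A} (hx : exp x ∈ K) :
    exp (-x) ∈ K := by
  obtain ⟨y, hy, h1, h2⟩ := hK.inv _ hx
  have : exp (-x) = y := by
    calc exp (-x) = exp (-x) * (exp x * y) := by rw [h1, mul_one]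
      _ = y := by rw [← mul_assoc, exp_neg_mul, one_mul]
  rwa [this]

theorem IsGrp.pow {K : Set A} (hK : IsGrp K) {x : A} (hx : x ∈ K) (m : ℕ) : x ^ m ∈ K := by
  induction m with
  | zero => simpa using hK.one
  | succ k ih => rw [pow_succ]; exact hK.mul _ ih _ hx

/-- limit directions are one-parameter groups -/
theorem lemA [CompleteSpace A] {K : Set A} (hK : IsGrp K) (hc : IsClosed K) (b : ℕ → A)
    (hb : Tendsto b atTop (𝓝 0)) (hne : ∀ j, b j ≠ 0) (hbK : ∀ j, exp (b j) ∈ K)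
    (W : Submodule ℝ A) (hW : ∀ j, b j ∈ W) :
    ∃ u ∈ W, u ≠ 0 ∧ ∀ s : ℝ, exp (s • u) ∈ K := by
  haveI : ProperSpace A := FiniteDimensional.proper ℝ A
  have hs : ∀ j, (‖b j‖⁻¹ • b j) ∈ Metric.sphere (0 : A) 1 := fun j => by
    have : ‖b j‖ ≠ 0 := norm_ne_zero_iff.2 (hne j)
    simp [norm_smul, this]
  obtain ⟨u, hu, φ, hφ, hlim⟩ := (isCompact_sphere (0 : A) 1).tendsto_subseq hs
  refine ⟨u, ?_, ?_, ?_⟩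
  · exact W.closed_of_finiteDimensional.mem_of_tendsto hlim
      (Eventually.of_forall fun j => W.smul_mem _ (hW _))
  · rintro rfl
    simp at hu
  · have key : ∀ s : ℝ, 0 ≤ s → exp (s • u) ∈ K := by
      intro s hs0
      have h1 : Tendsto (fun j => ‖b (φ j)‖⁻¹) atTop atTop := by
        apply Tendsto.inv_tendsto_nhdsGT_zero
        rw [tendsto_nhdsWithin_iff]
        refine ⟨?_, Eventually.of_forall fun j => norm_pos_iff.2 (hne _)⟩
        simpa using (hb.comp hφ.tendsto_atTop).norm
      have h2 := (tendsto_nat_floor_mul_div_atTop hs0).comp h1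
      have h3 := (h2.smul hlim)
      have h4 := (exp_continuous.tendsto _).comp h3
      refine hc.mem_of_tendsto h4 (Eventually.of_forall fun j => ?_)
      have hn : ‖b (φ j)‖ ≠ 0 := norm_ne_zero_iff.2 (hne _)
      have : ((⌊s * ‖b (φ j)‖⁻¹⌋₊ : ℝ) / ‖b (φ j)‖⁻¹) • (‖b (φ j)‖⁻¹ • b (φ j))
          = ⌊s * ‖b (φ j)‖⁻¹⌋₊ • b (φ j) := by
        rw [smul_smul, div_mul_cancel₀ _ (inv_ne_zero hn), Nat.cast_smul_eq_nsmul]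
      simp only [Function.comp]
      rw [this, exp_nsmul]
      exact hK.pow (hbK _) _
    intro s
    rcases le_total 0 s with h | h
    · exact key s h
    · have := hK.exp_neg (key (-s) (by linarith))
      simpa using this

theorem lemLog (C : Subalgebra ℝ A) (g : ℕ → A) (hg : Tendsto g atTop (𝓝 1))
    (hC : ∀ j, g j ∈ C) :
    ∃ L : ℕ → A, Tendsto L atTop (𝓝 0) ∧ (∀ j, L j ∈ C) ∧ ∀ᶠ j in atTop, exp (L j) = g j := by
  haveI : CompleteSpace A := FiniteDimensional.complete ℝ A
  haveI : FiniteDimensional ℝ C := inferInstanceAs (FiniteDimensional ℝ (Subalgebra.toSubmodule C))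
  haveI : CompleteSpace C := FiniteDimensional.complete ℝ C
  letI : NormedAlgebra ℚ C := NormedAlgebra.restrictScalars ℚ ℝ C
  have hd : HasStrictFDerivAt (exp : C → C) ((ContinuousLinearEquiv.refl ℝ C : C ≃L[ℝ] C) : C →L[ℝ] C) 0 :=
    hasStrictFDerivAt_exp_zero
  let g' : ℕ → C := fun j => ⟨g j, hC j⟩
  have hg' : Tendsto g' atTop (𝓝 (exp (0 : C))) := by
    rw [exp_zero, tendsto_subtype_rng]
    exact hg
  refine ⟨fun j => (hd.localInverse _ _ _ (g' j) : C), ?_, fun j => SetLike.coe_mem _, ?_⟩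
  · have := (continuous_subtype_val.tendsto (0 : C)).comp (hd.localInverse_tendsto.comp hg')
    exact this
  · filter_upwards [hg'.eventually hd.eventually_right_inverse] with j hj
    have h1 : C.val (exp (hd.localInverse _ _ _ (g' j))) = exp (C.val (hd.localInverse _ _ _ (g' j))) :=
      map_exp C.val continuous_subtype_val _
    rw [hj] at h1
    exact h1.symm

/-- recurrence -/
theorem lemRec {K : Set A} (hcpt : IsCompact K) (x y : ℕ → A) (hx : ∀ j, x j ∈ K)
    (hy : ∀ j, y j ∈ K) (hxy : ∀ j, x j * y j = 1) :
    ∃ φ : ℕ → ℕ, StrictMono φ ∧ Tendsto (fun j => x (φ (j + 1)) * y (φ j)) atTop (𝓝 1) := by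
  obtain ⟨⟨l, l'⟩, -, φ, hφ, hlim⟩ := (hcpt.prod hcpt).tendsto_subseq
    (x := fun j => (x j, y j)) (fun j => ⟨hx j, hy j⟩)
  refine ⟨φ, hφ, ?_⟩
  have h1 : Tendsto (fun j => x (φ j)) atTop (𝓝 l) := hlim.fst_nhds
  have h2 : Tendsto (fun j => y (φ j)) atTop (𝓝 l') := hlim.snd_nhds
  have h3 : l * l' = 1 := by
    have := h1.mul h2
    simp only [hxy] at this
    exact tendsto_nhds_unique this tendsto_const_nhds
  have h4 := (h1.comp (tendsto_add_atTop_nat 1)).mul h2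
  rw [h3] at h4
  exact h4

/-- commuting subspaces exponentiating into `K` -/
def Good (K : Set A) (t : Submodule ℝ A) : Prop :=
  (∀ x ∈ t, ∀ y ∈ t, x * y = y * x) ∧ ∀ x ∈ t, exp x ∈ K

theorem lemC {K : Set A} (hK : IsGrp K) (hc : IsClosed K) (t : Submodule ℝ A)
    (ht : Good K t) (hmax : ∀ t', Good K t' → ¬ t < t') (g : ℕ → A)
    (hgK : ∀ j, g j ∈ K) (hgt : ∀ j, ∀ x ∈ t, x * g j = g j * x)
    (hg : Tendsto g atTop (𝓝 1)) (ε : ℝ) (hε : 0 < ε) :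
    ∃ j, ∃ L ∈ t, ‖L‖ < ε ∧ exp L = g j := by
  haveI : CompleteSpace A := FiniteDimensional.complete ℝ A
  by_contra! hcon
  let C := Subalgebra.centralizer ℝ (t : Set A)
  have htC : ∀ x ∈ t, x ∈ C := fun x hx =>
    (Subalgebra.mem_centralizer_iff ℝ).2 fun y hy => ht.1 y hy x hx
  obtain ⟨L, hL0, hLC, hLe⟩ := lemLog C g hg
    (fun j => (Subalgebra.mem_centralizer_iff ℝ).2 (hgt j))
  obtain ⟨q, hq⟩ := t.exists_isCompl
  have hn : ∀ᶠ j in atTop, ‖L j‖ < ε := by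
    have := hL0.norm
    rw [norm_zero] at this
    exact this.eventually (gt_mem_nhds hε)
  obtain ⟨N, hN⟩ := eventually_atTop.1 (hLe.and hn)
  have hLt : ∀ j, L (j + N) ∉ t := fun j hj =>
    hcon (j + N) _ hj (hN _ (by omega)).2 (hN _ (by omega)).1
  obtain ⟨p, hp, hpq⟩ : ∃ p : A →ₗ[ℝ] A, (∀ x, x - p x ∈ t) ∧ ∀ x, p x ∈ q := by
    refine ⟨q.projection t hq.symm, fun x => ?_, fun x => by simp⟩
    have h := Submodule.projection_add_projection_eq_self hq x
    have h2 : x - q.projection t hq.symm x = t.projection q hq x := by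
      rw [sub_eq_iff_eq_add]; exact h.symm
    rw [h2]; simp
  have hLs : Tendsto (fun j => L (j + N)) atTop (𝓝 0) := hL0.comp (tendsto_add_atTop_nat N)
  have hpC : ∀ j, p (L j) ∈ C := fun j => by
    have := C.sub_mem (hLC j) (htC _ (hp (L j)))
    simpa using this
  obtain ⟨u, huW, hu0, hu⟩ := lemA hK hc (fun j => p (L (j + N)))
    (by
      have := (p.continuous_of_finiteDimensional.tendsto 0).comp hLs
      rw [map_zero] at this
      exact this)
    (fun j h0 => hLt j (by have := hp (L (j + N)); simpa [h0] using this))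
    (fun j => by
      have hcomm : Commute (L (j + N)) (-(L (j + N) - p (L (j + N)))) := by
        refine Commute.neg_right ?_
        exact ((Subalgebra.mem_centralizer_iff ℝ).1 (hLC (j + N)) _ (hp _)).symm
      have h1 : p (L (j + N)) = L (j + N) + -(L (j + N) - p (L (j + N))) := by abel
      rw [h1, exp_add_of_commute hcomm, (hN _ (by omega)).1]
      exact hK.mul _ (hgK _) _ (ht.2 _ (t.neg_mem (hp _))))
    (q ⊓ Subalgebra.toSubmodule C) (fun j => ⟨hpq _, hpC _⟩)
  have huC : ∀ x ∈ t, x * u = u * x := (Subalgebra.mem_centralizer_iff ℝ).1 huW.2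
  refine hmax (t ⊔ Submodule.span ℝ {u}) ⟨?_, ?_⟩ ?_
  · intro x hx y hy
    obtain ⟨a, ha, b, hb, rfl⟩ := Submodule.mem_sup.1 hx
    obtain ⟨a', ha', b', hb', rfl⟩ := Submodule.mem_sup.1 hy
    obtain ⟨r, rfl⟩ := Submodule.mem_span_singleton.1 hb
    obtain ⟨r', rfl⟩ := Submodule.mem_span_singleton.1 hb'
    simp only [mul_add, add_mul, smul_mul_assoc, mul_smul_comm, huC a ha, huC a' ha',
      ht.1 a ha a' ha', smul_add]
    rw [smul_comm r r']
    abel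
  · intro x hx
    obtain ⟨a, ha, b, hb, rfl⟩ := Submodule.mem_sup.1 hx
    obtain ⟨r, rfl⟩ := Submodule.mem_span_singleton.1 hb
    have hcomm : Commute a (r • u) := Commute.smul_right (huC a ha) r
    rw [exp_add_of_commute hcomm]
    exact hK.mul _ (ht.2 a ha) _ (hu r)
  · refine lt_of_le_of_ne le_sup_left fun h => hu0 ?_
    have hut : u ∈ t := by
      rw [h]
      exact Submodule.mem_sup_right (Submodule.mem_span_singleton_self u)
    exact (Submodule.disjoint_def.1 hq.disjoint) u hut huW.1

theorem main {K : Set A} (hK : IsGrp K) (hcpt : IsCompact K) (hinf : K.Infinite) :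
    ∃ x ∈ K, x ≠ 1 ∧ x ^ 2 = 1 := by
  haveI : CompleteSpace A := FiniteDimensional.complete ℝ A
  have hc := hcpt.isClosed
  obtain ⟨t, ht, hmax⟩ := (wellFounded_gt (α := Submodule ℝ A)).has_min {t | Good K t}
    ⟨⊥, by simp [Good, hK.one]⟩
  have hmax' : ∀ t', Good K t' → ¬ t < t' := fun t' h => hmax t' h
  -- `t` is nonzero
  have htne : ∃ X ∈ t, X ≠ 0 := by
    by_contra! h0
    let x : ℕ → A := fun j => hinf.natEmbedding K j
    have hx : ∀ j, x j ∈ K := fun j => Subtype.coe_prop _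
    have hxi : Function.Injective x := Subtype.val_injective.comp (hinf.natEmbedding K).injective
    choose y hy hxy hyx using fun j => hK.inv _ (hx j)
    obtain ⟨φ, hφ, hlim⟩ := lemRec hcpt x y hx hy hxy
    obtain ⟨j, L, hL, -, he⟩ := lemC hK hc t ht hmax' _
      (fun j => hK.mul _ (hx _) _ (hy _)) (fun j z hz => by simp [h0 z hz]) hlim 1 one_pos
    rw [h0 L hL, exp_zero] at he
    have h1 : x (φ (j + 1)) = x (φ j) := by
      calc x (φ (j + 1)) = x (φ (j + 1)) * (y (φ j) * x (φ j)) := by rw [hyx, mul_one]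
        _ = x (φ j) := by rw [← mul_assoc, ← he, one_mul]
    have h2 := hφ.injective (hxi h1)
    omega
  obtain ⟨X, hX, hX0⟩ := htne
  -- a nonzero period
  have hper : ∃ v ∈ t, v ≠ 0 ∧ exp v = 1 := by
    obtain ⟨φ, hφ, hlim⟩ := lemRec hcpt (fun j : ℕ => exp ((j : ℝ) • X))
      (fun j => exp (-((j : ℝ) • X))) (fun j => ht.2 _ (t.smul_mem _ hX))
      (fun j => ht.2 _ (t.neg_mem (t.smul_mem _ hX))) (fun j => exp_mul_neg _)
    have heq : ∀ j, exp (((φ (j + 1) : ℕ) : ℝ) • X) * exp (-(((φ j : ℕ) : ℝ) • X))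
        = exp ((((φ (j + 1) : ℕ) : ℝ) - ((φ j : ℕ) : ℝ)) • X) := fun j => by
      rw [← exp_add_of_commute]
      · rw [sub_smul, sub_eq_add_neg]
      · exact ht.1 _ (t.smul_mem _ hX) _ (t.neg_mem (t.smul_mem _ hX))
    simp only [heq] at hlim
    obtain ⟨j, L, hL, hLn, he⟩ := lemC hK hc t ht hmax' _
      (fun j => ht.2 _ (t.smul_mem _ hX))
      (fun j z hz => Commute.exp_right (ht.1 z hz _ (t.smul_mem _ hX))) hlim ‖X‖ (norm_pos_iff.2 hX0)
    set m : ℝ := ((φ (j + 1) : ℕ) : ℝ) - ((φ j : ℕ) : ℝ) with hm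
    have hm1 : 1 ≤ m := by
      have : φ j + 1 ≤ φ (j + 1) := hφ (Nat.lt_succ_self j)
      have : (φ j : ℝ) + 1 ≤ φ (j + 1) := by exact_mod_cast this
      linarith
    refine ⟨L + -(m • X), t.add_mem hL (t.neg_mem (t.smul_mem _ hX)), ?_, ?_⟩
    · intro h
      have h1 : L = m • X := by rwa [← sub_eq_add_neg, sub_eq_zero] at h
      rw [h1, norm_smul, Real.norm_of_nonneg (by linarith)] at hLn
      nlinarith [norm_pos_iff.2 hX0]
    · rw [exp_add_of_commute, he, exp_mul_neg]
      exact ht.1 _ hL _ (t.neg_mem (t.smul_mem _ hX))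
  obtain ⟨v, hv, hv0, hev⟩ := hper
  -- some `exp (v / 2^k)` is not `1`
  have hex : ∃ k : ℕ, exp (((1 / 2 : ℝ) ^ k) • v) ≠ 1 := by
    by_contra! hall
    have hd : HasStrictFDerivAt (exp : A → A)
        ((ContinuousLinearEquiv.refl ℝ A : A ≃L[ℝ] A) : A →L[ℝ] A) 0 :=
      hasStrictFDerivAt_exp_zero
    have hl : Tendsto (fun k : ℕ => ((1 / 2 : ℝ) ^ k) • v) atTop (𝓝 0) := by
      have := (tendsto_pow_atTop_nhds_zero_of_lt_one (r := (1 / 2 : ℝ)) (by norm_num)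
        (by norm_num)).smul_const v
      simpa using this
    obtain ⟨k, hk⟩ := (hl.eventually hd.eventually_left_inverse).exists
    rw [hall k, ← exp_zero (𝔸 := A), hd.localInverse_apply_image] at hk
    rcases smul_eq_zero.1 hk.symm with h | h
    · exact absurd h (by positivity)
    · exact hv0 h
  classical
  obtain ⟨k, hk, hmin⟩ : ∃ k, exp (((1 / 2 : ℝ) ^ k) • v) ≠ 1 ∧
      ∀ m < k, exp (((1 / 2 : ℝ) ^ m) • v) = 1 :=
    ⟨Nat.find hex, Nat.find_spec hex, fun m hm => not_not.1 (Nat.find_min hex hm)⟩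
  refine ⟨_, ht.2 _ (t.smul_mem ((1 / 2 : ℝ) ^ k) hv), hk, ?_⟩
  rw [← exp_nsmul]
  cases k with
  | zero => simp [hev] at hk
  | succ k =>
    rw [← Nat.cast_smul_eq_nsmul ℝ, smul_smul, ← hmin k (Nat.lt_succ_self k)]
    congr 2
    rw [pow_succ]; push_cast; ring

end Stmt8Aux

attribute [local instance] Matrix.linftyOpNormedRing Matrix.linftyOpNormedAlgebra in
theorem stmt8_main (n : ℕ) (K : Set (Matrix (Fin n) (Fin n) ℂ)) (hcpt : IsCompact K)
    (hinf : K.Infinite) (h1 : (1 : Matrix (Fin n) (Fin n) ℂ) ∈ K)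
    (hmul : ∀ x ∈ K, ∀ y ∈ K, x * y ∈ K)
    (hinv : ∀ x ∈ K, ∃ y ∈ K, x * y = 1 ∧ y * x = 1) :
    ∃ x ∈ K, x ≠ 1 ∧ x ^ 2 = 1 :=
  Stmt8Aux.main ⟨h1, hmul, hinv⟩ hcpt hinf

/-- An infinite subgroup of `GL_n(ℂ)` that is compact as a subset of the space of
complex `n × n` matrices contains a nontrivial element of order 2. -/
theorem stmt8 (n : ℕ) (hn : 1 ≤ n) (G : Subgroup (GL (Fin n) ℂ))
    (hcpt : IsCompact ((fun g : GL (Fin n) ℂ => (g : Matrix (Fin n) (Fin n) ℂ)) ''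
      (G : Set (GL (Fin n) ℂ))))
    (hinf : (G : Set (GL (Fin n) ℂ)).Infinite) :
    ∃ g ∈ G, g ≠ 1 ∧ g ^ 2 = 1 := by
  have hinj : Function.Injective
      (fun g : GL (Fin n) ℂ => (g : Matrix (Fin n) (Fin n) ℂ)) := fun a b h => Units.ext h
  obtain ⟨x, ⟨g, hg, rfl⟩, hne, hsq⟩ := stmt8_main n _ hcpt (hinf.image hinj.injOn)
    ⟨1, G.one_mem, rfl⟩
    (by
      rintro _ ⟨a, ha, rfl⟩ _ ⟨b, hb, rfl⟩
      exact ⟨a * b, G.mul_mem ha hb, rfl⟩)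
    (by
      rintro _ ⟨a, ha, rfl⟩
      exact ⟨_, ⟨a⁻¹, G.inv_mem ha, rfl⟩, a.mul_inv, a.inv_mul⟩)
  refine ⟨g, hg, fun h => hne (by rw [h]; rfl), Units.ext ?_⟩
  simpa using hsq
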